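/- Let ε = e^{iπ/4}, ω = e^{2πi/3}, R = ℤ[ε, ω] ⊆ ℂ, and let S = (1/√2)·[[−1, i], [−i, 1]], T = (1/√2)·[[ε, ε], [ε³, ε⁷]], U = (1/√2)·[[1, 1], [i, 1]]. Let G_8 be the subgroup of GL_2(ℂ) generated by U(εS)U^{−1} and U T U^{−1}. Then the ring of invariants R[1/3][x, y]^{G_8} is a polynomial ring over R[1/3]; more precisely it equals R[1/3][g, h], where g = x⁸ + 4(i−1)x⁷y − 14i x⁶y² + 14(i+1)x⁵y³ − 21x⁴y⁴ + 14(1−i)x³y⁵ + 14i x²y⁶ − 4(i+1)xy⁷ + y⁸ and h = 2x¹² + 12(i−1)x¹¹y − 66i x¹⁰y² + 110(i+1)x⁹y³ − 231x⁸y⁴ + 132(1−i)x⁷y⁵ + 132(i+1)x⁵y⁷ − 231x⁴y⁸ + 110(1−i)x³y⁹ + 66i x²y¹⁰ − 12(i+1)xy¹¹ + 2y¹². -/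

import Mathlib

set_option synthInstance.maxHeartbeats 1000000
set_option maxHeartbeats 1000000

open MvPolynomial Complex

/-- `ε = e^{iπ/4}`, a primitive eighth root of unity. -/
noncomputable def ε : ℂ := Complex.exp (Real.pi * Complex.I / 4)

/-- `ω = e^{2πi/3}`, a primitive third root of unity. -/
noncomputable def ω : ℂ := Complex.exp (2 * Real.pi * Complex.I / 3)

/-- `S = (1/√2)·[[−1, i], [−i, 1]]`. -/
noncomputable def Smat : Matrix (Fin 2) (Fin 2) ℂ :=
  ((Real.sqrt 2 : ℂ))⁻¹ • !![-1, I; -I, 1]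

/-- `T = (1/√2)·[[ε, ε], [ε³, ε⁷]]`. -/
noncomputable def Tmat : Matrix (Fin 2) (Fin 2) ℂ :=
  ((Real.sqrt 2 : ℂ))⁻¹ • !![ε, ε; ε^3, ε^7]

/-- `U = (1/√2)·[[1, 1], [i, 1]]`. -/
noncomputable def Umat : Matrix (Fin 2) (Fin 2) ℂ :=
  ((Real.sqrt 2 : ℂ))⁻¹ • !![1, 1; I, 1]

/-- The ring `R = ℤ[ε, ω] ⊆ ℂ`. -/
noncomputable def Rring : Subring ℂ := Subring.closure {ε, ω}

/-- The algebra endomorphism of `ℂ[x, y]` given by the linear substitution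
`x_i ↦ ∑_j M_{i,j} x_j` for a matrix `M`. -/
noncomputable def actC (M : Matrix (Fin 2) (Fin 2) ℂ) :
    MvPolynomial (Fin 2) ℂ →ₐ[ℂ] MvPolynomial (Fin 2) ℂ :=
  aeval fun i => ∑ j, C (M i j) * X j

/-- For a subring `R ⊆ ℂ` and a subgroup `G ⊆ GL_2(ℂ)`, the invariant ring `R[x, y]^G`:
the `R`-subalgebra of `ℂ[x, y]` consisting of the polynomials with all coefficients in `R`
that are fixed by the substitution action of every element of `G`. -/
noncomputable def invariantRingC (R : Subring ℂ) (G : Subgroup (GL (Fin 2) ℂ)) :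
    Subalgebra ↥R (MvPolynomial (Fin 2) ℂ) :=
  (MvPolynomial.mapAlgHom (R := ↥R) (σ := Fin 2) (Algebra.ofId ↥R ℂ)).range ⊓
    Subalgebra.restrictScalars ↥R
      (⨅ g ∈ G, AlgHom.equalizer (actC (g : Matrix (Fin 2) (Fin 2) ℂ)) (AlgHom.id ℂ _))

/-- The variable `x`. -/
noncomputable def xv : MvPolynomial (Fin 2) ℂ := X 0
/-- The variable `y`. -/
noncomputable def yv : MvPolynomial (Fin 2) ℂ := X 1

/-- `f = (i+1)x⁵y − 5x⁴y² + 5(1−i)x³y³ + 5i x²y⁴ − (i+1)xy⁵`. -/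
noncomputable def fpoly : MvPolynomial (Fin 2) ℂ :=
  C (I + 1) * xv^5 * yv - 5 * xv^4 * yv^2 + C (5*(1 - I)) * xv^3 * yv^3
    + C (5*I) * xv^2 * yv^4 - C (I + 1) * xv * yv^5

/-- `g = x⁸ + 4(i−1)x⁷y − 14i x⁶y² + 14(i+1)x⁵y³ − 21x⁴y⁴ + 14(1−i)x³y⁵ + 14i x²y⁶
      − 4(i+1)xy⁷ + y⁸`. -/
noncomputable def gpoly : MvPolynomial (Fin 2) ℂ :=
  xv^8 + C (4*(I - 1)) * xv^7 * yv - C (14*I) * xv^6 * yv^2 + C (14*(I + 1)) * xv^5 * yv^3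
    - 21 * xv^4 * yv^4 + C (14*(1 - I)) * xv^3 * yv^5 + C (14*I) * xv^2 * yv^6
    - C (4*(I + 1)) * xv * yv^7 + yv^8

/-- `h = 2x¹² + 12(i−1)x¹¹y − 66i x¹⁰y² + 110(i+1)x⁹y³ − 231x⁸y⁴ + 132(1−i)x⁷y⁵
      + 132(i+1)x⁵y⁷ − 231x⁴y⁸ + 110(1−i)x³y⁹ + 66i x²y¹⁰ − 12(i+1)xy¹¹ + 2y¹²`. -/
noncomputable def hpoly : MvPolynomial (Fin 2) ℂ :=
  2 * xv^12 + C (12*(I - 1)) * xv^11 * yv - C (66*I) * xv^10 * yv^2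
    + C (110*(I + 1)) * xv^9 * yv^3 - 231 * xv^8 * yv^4 + C (132*(1 - I)) * xv^7 * yv^5
    + C (132*(I + 1)) * xv^5 * yv^7 - 231 * xv^4 * yv^8 + C (110*(1 - I)) * xv^3 * yv^9
    + C (66*I) * xv^2 * yv^10 - C (12*(I + 1)) * xv * yv^11 + 2 * yv^12

/-- `G₈`: the subgroup of `GL_2(ℂ)` generated by `U(εS)U⁻¹` and `U T U⁻¹`
(Shephard–Todd group number 8 in its integral reflection representation). -/
noncomputable def G8 : Subgroup (GL (Fin 2) ℂ) :=
  Subgroup.closure {g | (g : Matrix (Fin 2) (Fin 2) ℂ) = Umat * (ε • Smat) * Umat⁻¹ ∨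
    (g : Matrix (Fin 2) (Fin 2) ℂ) = Umat * Tmat * Umat⁻¹}

/-- The ring `R[1/3] = ℤ[ε, ω, 1/3] ⊆ ℂ`. -/
noncomputable def Rring3 : Subring ℂ := Subring.closure {ε, ω, (3 : ℂ)⁻¹}

section LineRestriction

variable {S : Type*} [CommRing S]

/-- Restriction of a binary polynomial to the line spanned by `(t, 1)`. -/
noncomputable def lineHom (t : S) : MvPolynomial (Fin 2) S →ₐ[S] Polynomial S :=
  aeval ![Polynomial.C t * Polynomial.X, Polynomial.X]

theorem natDegree_lineHom_le (t : S) (P : MvPolynomial (Fin 2) S) :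
    (lineHom t P).natDegree ≤ P.totalDegree := by
  have h := aeval_natDegree_le (m := P.totalDegree) (n := 1) P le_rfl
    ![Polynomial.C t * Polynomial.X, Polynomial.X] (by
      intro i
      fin_cases i
      · exact (Polynomial.natDegree_C_mul_le _ _).trans Polynomial.natDegree_X_le
      · exact Polynomial.natDegree_X_le)
  simpa [lineHom] using h

/-- A linear substitution mapping the line through `(t, 1)` to the line through `(t', 1)`. -/
theorem lineHom_aeval_linear {a b c d t t' l : S} (h0 : a * t + b = l * t')
    (h1 : c * t + d = l) (P : MvPolynomial (Fin 2) S) :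
    lineHom t (aeval ![C a * X 0 + C b * X 1, C c * X 0 + C d * X 1] P) =
      (lineHom t' P).comp (Polynomial.C l * Polynomial.X) := by
  have key : (lineHom t).comp (aeval ![C a * X 0 + C b * X 1, C c * X 0 + C d * X 1]) =
      (Polynomial.aeval (Polynomial.C l * Polynomial.X)).comp (lineHom t') := by
    apply MvPolynomial.algHom_ext
    intro i
    have h0' := congrArg (Polynomial.C (R := S)) h0
    have h1' := congrArg (Polynomial.C (R := S)) h1
    simp only [map_add, map_mul] at h0' h1'
    fin_cases i
    · simp [lineHom, MvPolynomial.algHom_C]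
      linear_combination Polynomial.X * h0'
    · simp [lineHom, MvPolynomial.algHom_C]
      linear_combination Polynomial.X * h1'
  have := DFunLike.congr_fun key P
  simpa [Polynomial.aeval_def, Polynomial.comp, Polynomial.eval₂_eq_eval_map] using this

theorem totalDegree_aeval_le {h : MvPolynomial (Fin 2) S} {m : ℕ} (hh : h.totalDegree ≤ m)
    {q : Polynomial S} {N : ℕ} (hq : ∀ n, q.coeff n ≠ 0 → n * m ≤ N) :
    (Polynomial.aeval h q).totalDegree ≤ N := by
  rw [Polynomial.aeval_eq_sum_range' (Nat.lt_succ_self _)]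
  refine (totalDegree_finsetSum _ _).trans (Finset.sup_le fun n _ => ?_)
  by_cases h0 : q.coeff n = 0
  · simp [h0]
  · refine (totalDegree_smul_le _ _).trans ((totalDegree_pow _ _).trans ?_)
    exact (Nat.mul_le_mul_left n hh).trans (hq n h0)

variable [IsDomain S]

theorem prod_dvd_of_lineHom_eq_zero {ι : Type*} [Fintype ι] {t : ι → S}
    (ht : Function.Injective t) {P : MvPolynomial (Fin 2) S} (hP : ∀ k, lineHom (t k) P = 0) :
    ∏ k, (X 0 - C (t k) * X 1) ∣ P := by
  rcases eq_or_ne P 0 with rfl | hP0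
  · exact dvd_zero _
  have hroot (k : ι) : (finSuccEquiv S 1 P).IsRoot (C (t k) * X 0) := by
    have key : ((Polynomial.aeval (C (t k) * X 0 : MvPolynomial (Fin 1) S)).restrictScalars S).comp
        (finSuccEquiv S 1).toAlgHom = (Polynomial.aeval (X 0)).comp (lineHom (t k)) := by
      apply MvPolynomial.algHom_ext
      intro i
      fin_cases i
      · simp [lineHom, finSuccEquiv_X_zero]
      · have := finSuccEquiv_X_succ (R := S) (n := 1) (j := 0)
        simp only [Fin.succ_zero_eq_one] at this
        simp [lineHom, this]
    have := DFunLike.congr_fun key P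
    simpa [hP k, Polynomial.IsRoot.def, Polynomial.coe_aeval_eq_eval] using this
  have hinj : Function.Injective fun k => (C (t k) * X 0 : MvPolynomial (Fin 1) S) := by
    intro i j hij
    have := congrArg (eval fun _ => (1 : S)) hij
    exact ht (by simpa using this)
  have hdvd : ((Finset.univ.val.map fun k => (C (t k) * X 0 : MvPolynomial (Fin 1) S)).map
      fun a => Polynomial.X - Polynomial.C a).prod ∣ finSuccEquiv S 1 P := by
    rw [Multiset.prod_X_sub_C_dvd_iff_le_roots (by simpa using hP0),
      Multiset.le_iff_subset (Finset.univ.nodup.map hinj)]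
    intro a ha
    obtain ⟨k, -, rfl⟩ := Multiset.mem_map.1 ha
    exact (Polynomial.mem_roots (by simpa using hP0)).2 (hroot k)
  have hX1 := finSuccEquiv_X_succ (R := S) (n := 1) (j := 0)
  simp only [Fin.succ_zero_eq_one] at hX1
  have himg : finSuccEquiv S 1 (∏ k, (X 0 - C (t k) * X 1)) ∣ finSuccEquiv S 1 P := by
    convert hdvd using 1
    rw [map_prod, Multiset.map_map]
    refine Finset.prod_congr rfl fun k _ => ?_
    have hC : finSuccEquiv S 1 (C (t k)) = Polynomial.C (C (t k)) := by
      simp [finSuccEquiv_apply]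
    simp [finSuccEquiv_X_zero, hX1, hC]
  exact (map_dvd_iff (finSuccEquiv S 1)).1 himg

theorem totalDegree_prod_lines {ι : Type*} [Fintype ι] (t : ι → S) :
    (∏ k, (X 0 - C (t k) * X 1 : MvPolynomial (Fin 2) S)).totalDegree = Fintype.card ι := by
  have hne : eval ![1, 0] (∏ k, (X 0 - C (t k) * X 1 : MvPolynomial (Fin 2) S)) = 1 := by
    simp [map_prod]
  have hhom : (∏ k, (X 0 - C (t k) * X 1 : MvPolynomial (Fin 2) S)).IsHomogeneous
      (∑ _k : ι, 1) := by
    refine IsHomogeneous.prod _ _ _ fun k _ => (isHomogeneous_X S 0).sub ?_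
    simpa using (isHomogeneous_C (Fin 2) (t k)).mul (isHomogeneous_X S 1)
  rw [hhom.totalDegree (fun h => by simp [h] at hne)]
  simp

/-- A form of degree at most the number of lines on which it vanishes, normalized at `(1, 0)`,
divides every polynomial vanishing on these lines. -/
theorem dvd_of_lineHom_eq_zero {ι : Type*} [Fintype ι] {t : ι → S}
    (ht : Function.Injective t) {g P : MvPolynomial (Fin 2) S}
    (hdeg : g.totalDegree ≤ Fintype.card ι) (hg1 : eval ![1, 0] g = 1)
    (hg : ∀ k, lineHom (t k) g = 0) (hP : ∀ k, lineHom (t k) P = 0) : g ∣ P := by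
  obtain ⟨u, hu⟩ := prod_dvd_of_lineHom_eq_zero ht hg
  have hg0 : g ≠ 0 := by
    rintro rfl
    simp at hg1
  have hu0 : u ≠ 0 := by
    rintro rfl
    exact hg0 (by simpa using hu)
  have hp0 : ∏ k, (X 0 - C (t k) * X 1 : MvPolynomial (Fin 2) S) ≠ 0 := by
    intro h
    exact hg0 (by simpa [h] using hu)
  have hdu := totalDegree_mul_of_isDomain hp0 hu0
  rw [← hu, totalDegree_prod_lines] at hdu
  have huC := totalDegree_eq_zero_iff_eq_C.1 (show u.totalDegree = 0 by omega)
  have hu1 : u.coeff 0 = 1 := by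
    rw [hu, huC] at hg1
    simpa [map_prod] using hg1
  rw [hu1, map_one] at huC
  rw [hu, huC, mul_one]
  exact prod_dvd_of_lineHom_eq_zero ht hP

/-- The descent argument: an algebra `A` of binary polynomials is generated by `g` and `h` when
`g` cuts out a family of lines on which the elements of `A` vanish simultaneously, and `h`
restricts to a generator of the restriction of `A` to one of these lines. -/
theorem eq_adjoin_pair_of_lineHom {ι : Type*} [Fintype ι] {t : ι → S}
    (ht : Function.Injective t) (k₀ : ι) (A : Subalgebra S (MvPolynomial (Fin 2) S))
    {g h : MvPolynomial (Fin 2) S} (hgA : g ∈ A) (hhA : h ∈ A)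
    (hdeg : g.totalDegree ≤ Fintype.card ι) (hg1 : eval ![1, 0] g = 1)
    (hg : lineHom (t k₀) g = 0) {m : ℕ} (hm : m ≠ 0) {c c' : S} (hc : c * c' = 1)
    (hhdeg : h.totalDegree ≤ m)
    (hh : lineHom (t k₀) h = Polynomial.C c * Polynomial.X ^ m)
    (hvan : ∀ P ∈ A, lineHom (t k₀) P = 0 → ∀ k, lineHom (t k) P = 0)
    (hcoeff : ∀ P ∈ A, ∀ n, ¬ m ∣ n → (lineHom (t k₀) P).coeff n = 0)
    (hcancel : ∀ Q, g * Q ∈ A → Q ∈ A) : A = Algebra.adjoin S {g, h} := by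
  have hle : Algebra.adjoin S {g, h} ≤ A := by
    rw [Algebra.adjoin_le_iff]
    rintro _ (rfl | rfl)
    exacts [hgA, hhA]
  refine le_antisymm ?_ hle
  suffices ∀ N, ∀ P ∈ A, P.totalDegree < N → P ∈ Algebra.adjoin S {g, h} from
    fun P hP => this _ P hP (Nat.lt_succ_self _)
  intro N
  induction N with
  | zero => intro P _ hN; omega
  | succ N ih =>
    intro P hP hN
    set p := lineHom (t k₀) P with hp
    set q := (Polynomial.contract m p).comp (Polynomial.C c' * Polynomial.X) with hq
    have hqc (n : ℕ) : q.coeff n = p.coeff (n * m) * c' ^ n := by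
      rw [hq, Polynomial.comp_C_mul_X_coeff, Polynomial.coeff_contract hm]
    have hH : Polynomial.aeval h q ∈ Algebra.adjoin S {g, h} :=
      Algebra.adjoin_mono (by simp) (Polynomial.aeval_mem_adjoin_singleton S h)
    have hline : lineHom (t k₀) (Polynomial.aeval h q) = p := by
      rw [← Polynomial.aeval_algHom_apply, hh, hq, Polynomial.aeval_comp]
      have hcC : Polynomial.C c * Polynomial.C c' = 1 := by rw [← map_mul, hc, map_one]
      have : Polynomial.aeval (Polynomial.C c * Polynomial.X ^ m)
          (Polynomial.C c' * Polynomial.X) = (Polynomial.X ^ m : Polynomial S) := by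
        simp only [map_mul, Polynomial.aeval_C, Polynomial.aeval_X,
          ← Polynomial.C_eq_algebraMap]
        linear_combination Polynomial.X ^ m * hcC
      rw [this]
      change Polynomial.expand S m _ = p
      ext n
      rw [Polynomial.coeff_expand (Nat.pos_of_ne_zero hm)]
      split_ifs with hd
      · rw [Polynomial.coeff_contract hm, Nat.div_mul_cancel hd]
      · exact (hcoeff P hP n hd).symm
    have hHdeg : (Polynomial.aeval h q).totalDegree ≤ P.totalDegree := by
      refine totalDegree_aeval_le hhdeg fun n hn => ?_
      refine le_trans ?_ (natDegree_lineHom_le (t k₀) P)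
      refine Polynomial.le_natDegree_of_ne_zero fun h0 => hn ?_
      rw [hqc, hp, h0, zero_mul]
    have hD : P - Polynomial.aeval h q ∈ A := A.sub_mem hP (hle hH)
    obtain ⟨Q, hQ⟩ := dvd_of_lineHom_eq_zero ht hdeg hg1 (hvan g hgA hg)
      (hvan _ hD (by rw [map_sub, hline, sub_self]))
    have hQA : Q ∈ A := hcancel Q (hQ ▸ hD)
    have hPeq : P = g * Q + Polynomial.aeval h q := by rw [← hQ]; ring
    rw [hPeq]
    refine add_mem (mul_mem (Algebra.subset_adjoin (by simp)) ?_) hH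
    rcases eq_or_ne Q 0 with rfl | hQ0
    · exact zero_mem _
    have hg0 : g ≠ 0 := by
      rintro rfl
      simp at hg1
    have hgpos : g.totalDegree ≠ 0 := by
      intro h0
      rw [totalDegree_eq_zero_iff_eq_C.1 h0] at hg hg0
      refine hg0 ?_
      rw [lineHom, MvPolynomial.algHom_C, ← Polynomial.C_eq_algebraMap,
        Polynomial.C_eq_zero] at hg
      rw [hg, map_zero]
    have hmul := totalDegree_mul_of_isDomain hg0 hQ0
    have hsub := totalDegree_sub P (Polynomial.aeval h q)
    rw [hQ, max_eq_left hHdeg] at hsub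
    exact ih Q hQA (by omega)

theorem algebraicIndependent_pair_of_lineHom {t c : S} {g h : MvPolynomial (Fin 2) S}
    (hg0 : g ≠ 0) (hg : lineHom t g = 0) {m : ℕ} (hm : m ≠ 0) (hc : c ≠ 0)
    (hh : lineHom t h = Polynomial.C c * Polynomial.X ^ m) :
    AlgebraicIndependent S ![g, h] := by
  rw [algebraicIndependent_iff]
  suffices ∀ N, ∀ F : MvPolynomial (Fin 2) S, aeval ![g, h] F = 0 → F.totalDegree < N → F = 0 from
    fun F hF => this _ F hF (Nat.lt_succ_self _)
  intro N
  induction N with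
  | zero => intro P _ hN; omega
  | succ N ih =>
    intro F hF hN
    by_contra hF0
    have key : (lineHom t).comp (aeval ![g, h]) =
        (Polynomial.aeval (Polynomial.C c * Polynomial.X ^ m)).comp (lineHom (0 : S)) := by
      apply MvPolynomial.algHom_ext
      intro i
      fin_cases i <;> simp [hg, hh] <;> simp [lineHom]
    have hcomp : (lineHom 0 F).comp (Polynomial.C c * Polynomial.X ^ m) = 0 := by
      have := DFunLike.congr_fun key F
      rw [AlgHom.comp_apply, hF, map_zero] at this
      simpa [Polynomial.aeval_def, Polynomial.comp, Polynomial.eval₂_eq_eval_map]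
        using this.symm
    have hline : lineHom 0 F = 0 := by
      rcases Polynomial.comp_eq_zero_iff.1 hcomp with h0 | ⟨-, h0⟩
      · exact h0
      · have := congrArg Polynomial.natDegree h0
        rw [Polynomial.natDegree_C_mul_X_pow _ _ hc, Polynomial.natDegree_C] at this
        exact absurd this hm
    obtain ⟨Q, hQ⟩ := prod_dvd_of_lineHom_eq_zero (ι := Unit) (t := fun _ => 0)
      (fun _ _ _ => rfl) (fun _ => hline)
    simp only [map_zero, zero_mul, sub_zero, Finset.univ_unique, Finset.prod_const,
      Finset.card_singleton, pow_one] at hQ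
    have hQ0 : Q ≠ 0 := by
      rintro rfl
      exact hF0 (by simpa using hQ)
    have hmul := totalDegree_mul_of_isDomain (X_ne_zero (R := S) (0 : Fin 2)) hQ0
    rw [← hQ, totalDegree_X] at hmul
    refine hQ0 (ih Q ?_ (by omega))
    rw [hQ, map_mul, aeval_X] at hF
    exact (mul_eq_zero.1 hF).resolve_left hg0

end LineRestriction

section BinaryForms

variable {R : Type*} [CommRing R]

/-- The invariant form of degree `8`, with `a` in the role of the imaginary unit. -/
def octForm (a x y : R) : R :=
  x ^ 8 + 4 * (a - 1) * x ^ 7 * y - 14 * a * x ^ 6 * y ^ 2 + 14 * (a + 1) * x ^ 5 * y ^ 3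
    - 21 * x ^ 4 * y ^ 4 + 14 * (1 - a) * x ^ 3 * y ^ 5 + 14 * a * x ^ 2 * y ^ 6
    - 4 * (a + 1) * x * y ^ 7 + y ^ 8

/-- The invariant form of degree `12`, with `a` in the role of the imaginary unit. -/
def dodecForm (a x y : R) : R :=
  2 * x ^ 12 + 12 * (a - 1) * x ^ 11 * y - 66 * a * x ^ 10 * y ^ 2
    + 110 * (a + 1) * x ^ 9 * y ^ 3 - 231 * x ^ 8 * y ^ 4 + 132 * (1 - a) * x ^ 7 * y ^ 5
    + 132 * (a + 1) * x ^ 5 * y ^ 7 - 231 * x ^ 4 * y ^ 8 + 110 * (1 - a) * x ^ 3 * y ^ 9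
    + 66 * a * x ^ 2 * y ^ 10 - 12 * (a + 1) * x * y ^ 11 + 2 * y ^ 12

theorem map_octForm {R' F : Type*} [CommRing R'] [FunLike F R R'] [RingHomClass F R R'] (φ : F)
    (a x y : R) : φ (octForm a x y) = octForm (φ a) (φ x) (φ y) := by
  simp [octForm, map_ofNat φ]

theorem map_dodecForm {R' F : Type*} [CommRing R'] [FunLike F R R'] [RingHomClass F R R'] (φ : F)
    (a x y : R) : φ (dodecForm a x y) = dodecForm (φ a) (φ x) (φ y) := by
  simp [dodecForm, map_ofNat φ]

theorem octForm_rot {a : R} (ha : a ^ 2 = -1) (x y : R) :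
    octForm a (x + (a - 1) * y) (x - y) = octForm a x y := by
  unfold octForm
  grind

theorem dodecForm_rot {a : R} (ha : a ^ 2 = -1) (x y : R) :
    dodecForm a (x + (a - 1) * y) (x - y) = dodecForm a x y := by
  unfold dodecForm
  grind

theorem octForm_shear (a x y : R) : octForm a y (y - x) = octForm a x y := by
  unfold octForm
  ring

theorem dodecForm_shear (a x y : R) : dodecForm a y (y - x) = dodecForm a x y := by
  unfold dodecForm
  ring

theorem octForm_line {a z : R} (ha : a ^ 2 = -1) (hz : z ^ 2 = z - 1) (x : R) :
    octForm a (z * x) x = 0 := by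
  unfold octForm
  grind

theorem dodecForm_line {a z : R} (ha : a ^ 2 = -1) (hz : z ^ 2 = z - 1) (x : R) :
    dodecForm a (z * x) x = (135 - 78 * a * (2 * z - 1)) * x ^ 12 := by
  unfold dodecForm
  grind

theorem isHomogeneous_C_mul_X_pow_mul_X_pow (c : R) (i j : ℕ) :
    (C c * X 0 ^ i * X 1 ^ j : MvPolynomial (Fin 2) R).IsHomogeneous (i + j) := by
  have h := ((isHomogeneous_C (Fin 2) c).mul (isHomogeneous_X_pow (R := R) 0 i)).mul
    (isHomogeneous_X_pow (R := R) (1 : Fin 2) j)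
  rwa [zero_add] at h

theorem isHomogeneous_octForm (a : R) :
    (octForm (C a) (X 0) (X 1) : MvPolynomial (Fin 2) R).IsHomogeneous 8 := by
  have e := isHomogeneous_C_mul_X_pow_mul_X_pow (R := R)
  have h := ((((((((e 1 8 0).add (e (4 * (a - 1)) 7 1)).add (e (-14 * a) 6 2)).add
    (e (14 * (a + 1)) 5 3)).add (e (-21) 4 4)).add (e (14 * (1 - a)) 3 5)).add
    (e (14 * a) 2 6)).add (e (-4 * (a + 1)) 1 7)).add (e 1 0 8)
  convert h using 1
  simp only [octForm, map_mul, map_sub, map_add, map_neg, map_one, map_ofNat]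
  ring

theorem isHomogeneous_dodecForm (a : R) :
    (dodecForm (C a) (X 0) (X 1) : MvPolynomial (Fin 2) R).IsHomogeneous 12 := by
  have e := isHomogeneous_C_mul_X_pow_mul_X_pow (R := R)
  have h := (((((((((((e 2 12 0).add (e (12 * (a - 1)) 11 1)).add (e (-66 * a) 10 2)).add
    (e (110 * (a + 1)) 9 3)).add (e (-231) 8 4)).add (e (132 * (1 - a)) 7 5)).add
    (e (132 * (a + 1)) 5 7)).add (e (-231) 4 8)).add (e (110 * (1 - a)) 3 9)).add
    (e (66 * a) 2 10)).add (e (-12 * (a + 1)) 1 11)).add (e 2 0 12)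
  convert h using 1
  simp only [dodecForm, map_mul, map_sub, map_add, map_neg, map_one, map_ofNat]
  ring

theorem twelve_dvd_of_pow_eq_one [IsDomain R] [CharZero R] {a z : R} (ha : a ^ 2 = -1)
    (hz : z ^ 2 = z - 1) {n : ℕ} (h1 : a ^ n = 1) (h2 : (1 - z) ^ n = 1) : 12 ∣ n := by
  have h4 : n % 4 = 0 := by
    have ha4 : a ^ 4 = 1 := by linear_combination (a ^ 2 - 1) * ha
    rw [← Nat.div_add_mod n 4, pow_add, pow_mul, ha4, one_pow, one_mul] at h1
    have := Nat.mod_lt n (show 4 > 0 by norm_num)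
    generalize n % 4 = r at *
    interval_cases r
    · rfl
    · exfalso
      have : (2 : R) = 0 := by linear_combination ha - (a + 1) * h1
      norm_num at this
    · exfalso
      have : (2 : R) = 0 := by linear_combination ha - h1
      norm_num at this
    · exfalso
      have : (2 : R) = 0 := by linear_combination ha - (a - 1) * (a * ha - h1)
      norm_num at this
  have h3 : n % 3 = 0 := by
    have hw3 : (-z) ^ 3 = 1 := by linear_combination (-z - 1) * hz
    have h2' : (-z) ^ n = 1 := by
      have : (-z) = (1 - z) ^ 2 := by linear_combination -hz
      rw [this, ← pow_mul, mul_comm, pow_mul, h2, one_pow]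
    rw [← Nat.div_add_mod n 3, pow_add, pow_mul, hw3, one_pow, one_mul] at h2'
    have := Nat.mod_lt n (show 3 > 0 by norm_num)
    generalize n % 3 = r at *
    interval_cases r
    · rfl
    · exfalso
      have : (3 : R) = 0 := by linear_combination hz + (z - 2) * h2'
      norm_num at this
    · exfalso
      have : (3 : R) = 0 := by linear_combination (z + 2) * hz - (z + 1) * h2'
      norm_num at this
  omega

end BinaryForms

theorem eps_eq : ε = (Real.sqrt 2 : ℂ)⁻¹ * (1 + I) := by
  have h : ((Real.pi : ℂ) * I / 4) = ((Real.pi / 4 : ℝ) : ℂ) * I := by push_cast; ring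
  have h2 : (Real.sqrt 2 : ℂ) ^ 2 = 2 := by
    rw [← Complex.ofReal_pow, Real.sq_sqrt (by norm_num)]; norm_num
  have h0 : (Real.sqrt 2 : ℂ) ≠ 0 := by
    intro h0
    rw [h0] at h2
    norm_num at h2
  rw [ε, h, Complex.exp_mul_I, ← Complex.ofReal_cos, ← Complex.ofReal_sin, Real.cos_pi_div_four,
    Real.sin_pi_div_four]
  push_cast
  field_simp
  linear_combination (1 + I) * h2

theorem eps_sq : ε ^ 2 = I := by
  have h2 : ((Real.sqrt 2 : ℂ)⁻¹) ^ 2 = 1 / 2 := by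
    rw [inv_pow, ← Complex.ofReal_pow, Real.sq_sqrt (by norm_num)]; norm_num
  rw [eps_eq]
  linear_combination (1 + I) ^ 2 * h2 + 1 / 2 * I_sq

theorem omega_eq : ω = -1 / 2 + Real.sqrt 3 / 2 * I := by
  have h : (2 * (Real.pi : ℂ) * I / 3) = ((Real.pi - Real.pi / 3 : ℝ) : ℂ) * I := by
    push_cast; ring
  rw [ω, h, Complex.exp_mul_I, ← Complex.ofReal_cos, ← Complex.ofReal_sin, Real.cos_pi_sub,
    Real.sin_pi_sub, Real.cos_pi_div_three, Real.sin_pi_div_three]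
  push_cast
  ring

theorem sq_one_add_omega : (1 + ω) ^ 2 = (1 + ω) - 1 := by
  have h3 : (Real.sqrt 3 : ℂ) ^ 2 = 3 := by
    rw [← Complex.ofReal_pow, Real.sq_sqrt (by norm_num)]; norm_num
  rw [omega_eq]
  linear_combination (Real.sqrt 3 : ℂ) ^ 2 / 4 * I_sq - h3 / 4

theorem Umat_conj_smul_Smat : Umat * (ε • Smat) * Umat⁻¹ = !![1, I - 1; 1, -1] := by
  have h2 : ((Real.sqrt 2 : ℂ)⁻¹) ^ 2 = 1 / 2 := by
    rw [inv_pow, ← Complex.ofReal_pow, Real.sq_sqrt (by norm_num)]; norm_num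
  have hdet : IsUnit Umat.det := by
    rw [isUnit_iff_ne_zero, Umat, Matrix.det_smul, Matrix.det_fin_two_of]
    intro h
    simp [sub_eq_zero, Complex.ext_iff] at h
  have h : Umat * (ε • Smat) = !![1, I - 1; 1, -1] * Umat := by
    rw [eps_eq, Umat, Smat]
    generalize (Real.sqrt 2 : ℂ)⁻¹ = s at *
    ext i j
    fin_cases i <;> fin_cases j <;> simp [Matrix.mul_apply] <;> grind [I_sq]
  rw [h, Matrix.mul_nonsing_inv_cancel_right _ _ hdet]

theorem Umat_conj_Tmat : Umat * Tmat * Umat⁻¹ = !![0, 1; -1, 1] := by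
  have h2 : ((Real.sqrt 2 : ℂ)⁻¹) ^ 2 = 1 / 2 := by
    rw [inv_pow, ← Complex.ofReal_pow, Real.sq_sqrt (by norm_num)]; norm_num
  have hdet : IsUnit Umat.det := by
    rw [isUnit_iff_ne_zero, Umat, Matrix.det_smul, Matrix.det_fin_two_of]
    intro h
    simp [sub_eq_zero, Complex.ext_iff] at h
  have h : Umat * Tmat = !![0, 1; -1, 1] * Umat := by
    have e3 : ε ^ 3 = I * ε := by rw [pow_succ, eps_sq]
    have e7 : ε ^ 7 = -I * ε := by
      rw [show ε ^ 7 = (ε ^ 2) ^ 3 * ε by ring, eps_sq]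
      linear_combination I * ε * I_sq
    rw [Umat, Tmat, e3, e7, eps_eq]
    generalize (Real.sqrt 2 : ℂ)⁻¹ = s at *
    ext i j
    fin_cases i <;> fin_cases j <;> simp [Matrix.mul_apply] <;> grind [I_sq]
  rw [h, Matrix.mul_nonsing_inv_cancel_right _ _ hdet]

theorem actC_mul (M N : Matrix (Fin 2) (Fin 2) ℂ) (P : MvPolynomial (Fin 2) ℂ) :
    actC (M * N) P = actC N (actC M P) := by
  rw [← AlgHom.comp_apply]
  congr 1
  apply MvPolynomial.algHom_ext
  intro i
  simp only [actC, aeval_X, AlgHom.comp_apply, map_mul, Matrix.mul_apply,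
    Fin.sum_univ_two, map_add, MvPolynomial.algHom_C, MvPolynomial.algebraMap_eq]
  ring

theorem actC_one (P : MvPolynomial (Fin 2) ℂ) : actC 1 P = P := by
  have : actC 1 = AlgHom.id ℂ _ := by
    apply MvPolynomial.algHom_ext
    intro i
    fin_cases i <;> simp [actC]
  rw [this, AlgHom.id_apply]

/-- The subgroup of `GL₂(ℂ)` fixing a polynomial. -/
def fixingSubgroup₂ (P : MvPolynomial (Fin 2) ℂ) : Subgroup (GL (Fin 2) ℂ) where
  carrier := {g | actC (g : Matrix (Fin 2) (Fin 2) ℂ) P = P}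
  one_mem' := actC_one P
  mul_mem' {g g'} hg hg' := by
    change actC _ P = P at hg hg' ⊢
    rw [Units.val_mul, actC_mul, hg, hg']
  inv_mem' {g} hg := by
    change actC _ P = P at hg ⊢
    conv_lhs => rw [← hg]
    rw [← actC_mul, ← Units.val_mul, mul_inv_cancel, Units.val_one, actC_one]

theorem G8_le_fixingSubgroup₂_iff (P : MvPolynomial (Fin 2) ℂ) :
    (∀ g ∈ G8, actC (g : Matrix (Fin 2) (Fin 2) ℂ) P = P) ↔
      actC !![1, I - 1; 1, -1] P = P ∧ actC !![0, 1; -1, 1] P = P := by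
  change G8 ≤ fixingSubgroup₂ P ↔ _
  rw [G8, Subgroup.closure_le]
  constructor
  · intro h
    refine ⟨?_, ?_⟩
    · exact @h (Matrix.GeneralLinearGroup.mkOfDetNeZero !![1, I - 1; 1, -1] (by
        rw [Matrix.det_fin_two_of]; intro h; simp [Complex.ext_iff] at h))
        (Or.inl Umat_conj_smul_Smat.symm)
    · exact @h (Matrix.GeneralLinearGroup.mkOfDetNeZero !![0, 1; -1, 1] (by simp))
        (Or.inr Umat_conj_Tmat.symm)
  · rintro ⟨h1, h2⟩ g (hg | hg)
    · rw [Umat_conj_smul_Smat] at hg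
      change actC (g : Matrix (Fin 2) (Fin 2) ℂ) P = P
      rw [hg, h1]
    · rw [Umat_conj_Tmat] at hg
      change actC (g : Matrix (Fin 2) (Fin 2) ℂ) P = P
      rw [hg, h2]

section Descent

/-- Extension of scalars from `R[1/3]` to `ℂ`. -/
noncomputable def toComplex :
    MvPolynomial (Fin 2) Rring3 →ₐ[Rring3] MvPolynomial (Fin 2) ℂ :=
  MvPolynomial.mapAlgHom (Algebra.ofId Rring3 ℂ)

theorem toComplex_C (a : Rring3) : toComplex (C a) = C (a : ℂ) := by
  simp [toComplex]
  rfl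

theorem toComplex_X (i : Fin 2) : toComplex (X i) = X i := by
  simp [toComplex]

theorem toComplex_injective : Function.Injective toComplex := by
  change Function.Injective (MvPolynomial.map (σ := Fin 2) (Algebra.ofId Rring3 ℂ : Rring3 →+* ℂ))
  exact MvPolynomial.map_injective _ Subtype.val_injective

theorem actC_toComplex (a b c d : Rring3) (P : MvPolynomial (Fin 2) Rring3) :
    actC !![(a : ℂ), b; c, d] (toComplex P) =
      toComplex (aeval ![C a * X 0 + C b * X 1, C c * X 0 + C d * X 1] P) := by
  have key : ((actC !![(a : ℂ), b; c, d]).restrictScalars Rring3).comp toComplex =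
      toComplex.comp (aeval ![C a * X 0 + C b * X 1, C c * X 0 + C d * X 1]) := by
    apply MvPolynomial.algHom_ext
    intro i
    fin_cases i <;> simp [actC, toComplex_X] <;> rfl
  exact DFunLike.congr_fun key P

theorem eps_mem : ε ∈ Rring3 := Subring.subset_closure (by simp)

theorem omega_mem : ω ∈ Rring3 := Subring.subset_closure (by simp)

theorem inv_three_mem : (3 : ℂ)⁻¹ ∈ Rring3 := Subring.subset_closure (by simp)

/-- The imaginary unit as an element of `R[1/3]`. -/
noncomputable def imUnit : Rring3 := ⟨I, eps_sq ▸ pow_mem eps_mem 2⟩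

/-- The primitive sixth root of unity `1 + ω` as an element of `R[1/3]`. -/
noncomputable def sixthRoot : Rring3 := ⟨1 + ω, add_mem (one_mem _) omega_mem⟩

theorem imUnit_sq : imUnit ^ 2 = -1 := Subtype.ext I_sq

theorem sixthRoot_sq : sixthRoot ^ 2 = sixthRoot - 1 := Subtype.ext sq_one_add_omega

/-- The slopes of the eight lines on which `gpoly` vanishes. -/
noncomputable def octSlope : Fin 8 → Rring3 :=
  ![sixthRoot, 1 - imUnit * sixthRoot, imUnit * (sixthRoot - 1), -(imUnit * sixthRoot),
    sixthRoot - imUnit, 1 - sixthRoot - imUnit, 1 + imUnit * (sixthRoot - 1), 1 - sixthRoot]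

theorem octSlope_injective : Function.Injective octSlope := by
  have hi : (imUnit : ℂ) = I := rfl
  have hz : (sixthRoot : ℂ) = 1 / 2 + Real.sqrt 3 / 2 * I := by
    change 1 + ω = _
    rw [omega_eq]
    ring
  have h3 : Real.sqrt 3 ^ 2 = 3 := Real.sq_sqrt (by norm_num)
  have h3' : 0 ≤ Real.sqrt 3 := Real.sqrt_nonneg 3
  have lo : 1.7 < Real.sqrt 3 := by nlinarith
  have hi' : Real.sqrt 3 < 1.8 := by nlinarith
  intro i j hij
  have h := congrArg (Subtype.val : Rring3 → ℂ) hij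
  have hre := congrArg Complex.re h
  have him := congrArg Complex.im h
  clear h hij
  fin_cases i <;> fin_cases j <;> first
    | rfl
    | (exfalso
       simp [octSlope, hi, hz] at hre him <;> linarith)

/-- `gpoly` over `R[1/3]`. -/
noncomputable def gpoly₃ : MvPolynomial (Fin 2) Rring3 := octForm (C imUnit) (X 0) (X 1)

/-- `hpoly` over `R[1/3]`. -/
noncomputable def hpoly₃ : MvPolynomial (Fin 2) Rring3 := dodecForm (C imUnit) (X 0) (X 1)

theorem toComplex_gpoly₃ : toComplex gpoly₃ = gpoly := by
  rw [gpoly₃, map_octForm, toComplex_C, toComplex_X, toComplex_X]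
  change octForm (C I) xv yv = gpoly
  simp only [octForm, gpoly, map_mul, map_sub, map_add, map_one, map_ofNat]

theorem toComplex_hpoly₃ : toComplex hpoly₃ = hpoly := by
  rw [hpoly₃, map_dodecForm, toComplex_C, toComplex_X, toComplex_X]
  change dodecForm (C I) xv yv = hpoly
  simp only [dodecForm, hpoly, map_mul, map_sub, map_add, map_one, map_ofNat]

/-- The invariants of `G8`, as polynomials over `R[1/3]`. -/
noncomputable def invariants₃ : Subalgebra Rring3 (MvPolynomial (Fin 2) Rring3) :=
  (invariantRingC Rring3 G8).comap toComplex

/-- The substitution by the generator of `G8` of determinant `-i`. -/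
noncomputable def rotHom :
    MvPolynomial (Fin 2) Rring3 →ₐ[Rring3] MvPolynomial (Fin 2) Rring3 :=
  aeval ![C 1 * X 0 + C (imUnit - 1) * X 1, C 1 * X 0 + C (-1) * X 1]

/-- The substitution by the generator of `G8` of determinant `1`. -/
noncomputable def shearHom :
    MvPolynomial (Fin 2) Rring3 →ₐ[Rring3] MvPolynomial (Fin 2) Rring3 :=
  aeval ![C 0 * X 0 + C 1 * X 1, C (-1) * X 0 + C 1 * X 1]

theorem rotHom_X_zero : rotHom (X 0) = X 0 + (C imUnit - 1) * X 1 := by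
  simp [rotHom]

theorem rotHom_X_one : rotHom (X 1) = X 0 - X 1 := by
  simp only [rotHom, aeval_X, Matrix.cons_val, map_neg, map_one]
  ring

theorem shearHom_X_zero : shearHom (X 0) = X 1 := by
  simp [shearHom]

theorem shearHom_X_one : shearHom (X 1) = X 1 - X 0 := by
  simp only [shearHom, aeval_X, Matrix.cons_val, map_neg, map_one]
  ring

theorem mem_invariants₃ {P : MvPolynomial (Fin 2) Rring3} :
    P ∈ invariants₃ ↔ rotHom P = P ∧ shearHom P = P := by
  have h1 : actC !![1, I - 1; 1, -1] (toComplex P) = toComplex (rotHom P) := by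
    rw [rotHom, ← actC_toComplex]
    simp [imUnit]
  have h2 : actC !![0, 1; -1, 1] (toComplex P) = toComplex (shearHom P) := by
    rw [shearHom, ← actC_toComplex]
    simp
  have h3 : P ∈ invariants₃ ↔
      ∀ g ∈ G8, actC (g : Matrix (Fin 2) (Fin 2) ℂ) (toComplex P) = toComplex P := by
    rw [invariants₃, Subalgebra.mem_comap, invariantRingC, Algebra.mem_inf]
    simp only [Subalgebra.mem_restrictScalars, Algebra.mem_iInf, AlgHom.mem_equalizer,
      AlgHom.id_apply]
    exact and_iff_right ⟨P, rfl⟩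
  rw [h3, G8_le_fixingSubgroup₂_iff, h1, h2, toComplex_injective.eq_iff,
    toComplex_injective.eq_iff]

theorem gpoly₃_mem : gpoly₃ ∈ invariants₃ := by
  rw [mem_invariants₃]
  constructor
  · have h := octForm_rot (a := (C imUnit : MvPolynomial (Fin 2) Rring3))
      (by rw [← map_pow, imUnit_sq, map_neg, map_one]) (X 0) (X 1)
    rwa [gpoly₃, map_octForm, rotHom_X_zero, rotHom_X_one, MvPolynomial.algHom_C,
      MvPolynomial.algebraMap_eq]
  · have h := octForm_shear (C imUnit : MvPolynomial (Fin 2) Rring3) (X 0) (X 1)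
    rwa [gpoly₃, map_octForm, shearHom_X_zero, shearHom_X_one, MvPolynomial.algHom_C,
      MvPolynomial.algebraMap_eq]

theorem hpoly₃_mem : hpoly₃ ∈ invariants₃ := by
  rw [mem_invariants₃]
  constructor
  · have h := dodecForm_rot (a := (C imUnit : MvPolynomial (Fin 2) Rring3))
      (by rw [← map_pow, imUnit_sq, map_neg, map_one]) (X 0) (X 1)
    rwa [hpoly₃, map_dodecForm, rotHom_X_zero, rotHom_X_one, MvPolynomial.algHom_C,
      MvPolynomial.algebraMap_eq]
  · have h := dodecForm_shear (C imUnit : MvPolynomial (Fin 2) Rring3) (X 0) (X 1)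
    rwa [hpoly₃, map_dodecForm, shearHom_X_zero, shearHom_X_one, MvPolynomial.algHom_C,
      MvPolynomial.algebraMap_eq]

theorem lineHom_comp_rot {P : MvPolynomial (Fin 2) Rring3} (hP : P ∈ invariants₃)
    {t t' : Rring3} (h : t + (imUnit - 1) = (t - 1) * t') :
    lineHom t P = (lineHom t' P).comp (Polynomial.C (t - 1) * Polynomial.X) := by
  conv_lhs => rw [← (mem_invariants₃.1 hP).1]
  exact lineHom_aeval_linear (by rw [one_mul, h]) (by ring) P

theorem lineHom_comp_shear {P : MvPolynomial (Fin 2) Rring3} (hP : P ∈ invariants₃)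
    {t t' : Rring3} (h : 1 = (1 - t) * t') :
    lineHom t P = (lineHom t' P).comp (Polynomial.C (1 - t) * Polynomial.X) := by
  conv_lhs => rw [← (mem_invariants₃.1 hP).2]
  exact lineHom_aeval_linear (by rw [← h]; ring) (by ring) P

theorem eq_zero_of_comp_C_mul_X {S : Type*} [CommRing S] [IsDomain S] {p : Polynomial S} {l : S}
    (hl : l ≠ 0) (h : p.comp (Polynomial.C l * Polynomial.X) = 0) : p = 0 := by
  ext n
  have := congrArg (fun q => Polynomial.coeff q n) h
  simpa [Polynomial.comp_C_mul_X_coeff, hl] using this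

theorem lineHom_rot_eq_zero {P : MvPolynomial (Fin 2) Rring3} (hP : P ∈ invariants₃)
    {t t' : Rring3} (h : t + (imUnit - 1) = (t - 1) * t') (h0 : lineHom t P = 0) :
    lineHom t' P = 0 := by
  rw [lineHom_comp_rot hP h] at h0
  refine eq_zero_of_comp_C_mul_X (fun hl => ?_) h0
  have hi : imUnit = 0 := by linear_combination h + (t' - 1) * hl
  have := imUnit_sq
  rw [hi] at this
  norm_num at this

theorem lineHom_shear_eq_zero {P : MvPolynomial (Fin 2) Rring3} (hP : P ∈ invariants₃)
    {t t' : Rring3} (h : 1 = (1 - t) * t') (h0 : lineHom t P = 0) :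
    lineHom t' P = 0 := by
  rw [lineHom_comp_shear hP h] at h0
  exact eq_zero_of_comp_C_mul_X (left_ne_zero_of_mul (h ▸ one_ne_zero)) h0

theorem lineHom_octSlope_eq_zero {P : MvPolynomial (Fin 2) Rring3} (hP : P ∈ invariants₃)
    (h0 : lineHom (octSlope 0) P = 0) (k : Fin 8) : lineHom (octSlope k) P = 0 := by
  have ha := imUnit_sq
  have hz := sixthRoot_sq
  have e1 : lineHom (octSlope 1) P = 0 := by
    refine lineHom_rot_eq_zero hP ?_ h0
    simp only [octSlope, Matrix.cons_val]
    linear_combination imUnit * hz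
  have e2 : lineHom (octSlope 2) P = 0 := by
    refine lineHom_shear_eq_zero hP ?_ e1
    simp only [octSlope, Matrix.cons_val]
    linear_combination -(sixthRoot ^ 2 - sixthRoot) * ha + hz
  have e3 : lineHom (octSlope 3) P = 0 := by
    refine lineHom_rot_eq_zero hP ?_ e2
    simp only [octSlope, Matrix.cons_val]
    linear_combination (sixthRoot ^ 2 - sixthRoot) * ha - hz
  have e4 : lineHom (octSlope 4) P = 0 := by
    refine lineHom_shear_eq_zero hP ?_ e2
    simp only [octSlope, Matrix.cons_val]
    linear_combination (1 - sixthRoot) * ha + imUnit * hz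
  have e5 : lineHom (octSlope 5) P = 0 := by
    refine lineHom_rot_eq_zero hP ?_ e4
    simp only [octSlope, Matrix.cons_val]
    linear_combination hz - ha
  have e6 : lineHom (octSlope 6) P = 0 := by
    refine lineHom_shear_eq_zero hP ?_ e5
    simp only [octSlope, Matrix.cons_val]
    linear_combination (1 - sixthRoot) * ha - imUnit * hz
  have e7 : lineHom (octSlope 7) P = 0 := by
    refine lineHom_rot_eq_zero hP ?_ e6
    simp only [octSlope, Matrix.cons_val]
    linear_combination imUnit * hz
  fin_cases k
  exacts [h0, e1, e2, e3, e4, e5, e6, e7]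

theorem coeff_lineHom_sixthRoot {P : MvPolynomial (Fin 2) Rring3} (hP : P ∈ invariants₃)
    {n : ℕ} (hn : ¬ 12 ∣ n) : (lineHom sixthRoot P).coeff n = 0 := by
  have ha := imUnit_sq
  have hz := sixthRoot_sq
  by_contra h0
  refine hn (twelve_dvd_of_pow_eq_one ha hz ?_ ?_)
  · have h1 := lineHom_comp_rot hP (t := sixthRoot) (t' := 1 - imUnit * sixthRoot)
      (by linear_combination imUnit * hz)
    have h2 := lineHom_comp_rot hP (t := 1 - imUnit * sixthRoot) (t' := sixthRoot)
      (by linear_combination imUnit * hz)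
    have hc : (lineHom sixthRoot P).coeff n = (lineHom sixthRoot P).coeff n * imUnit ^ n := by
      conv_lhs => rw [h1, h2, Polynomial.comp_C_mul_X_coeff, Polynomial.comp_C_mul_X_coeff,
        mul_assoc, ← mul_pow]
      congr 2
      linear_combination -imUnit * hz
    exact mul_left_cancel₀ h0 (by rw [← hc, mul_one])
  · have h1 := lineHom_comp_shear hP (t := sixthRoot) (t' := sixthRoot) (by linear_combination hz)
    have hc : (lineHom sixthRoot P).coeff n =
        (lineHom sixthRoot P).coeff n * (1 - sixthRoot) ^ n := by
      conv_lhs => rw [h1, Polynomial.comp_C_mul_X_coeff]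
    exact mul_left_cancel₀ h0 (by rw [← hc, mul_one])

theorem lineHom_gpoly₃ : lineHom sixthRoot gpoly₃ = 0 := by
  have h := octForm_line (a := Polynomial.C imUnit) (z := Polynomial.C sixthRoot)
    (by rw [← map_pow, imUnit_sq, map_neg, map_one])
    (by rw [← map_pow, sixthRoot_sq, map_sub, map_one]) Polynomial.X
  rw [gpoly₃, map_octForm]
  simpa [lineHom] using h

theorem lineHom_hpoly₃ : lineHom sixthRoot hpoly₃ =
    Polynomial.C (135 - 78 * imUnit * (2 * sixthRoot - 1)) * Polynomial.X ^ 12 := by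
  have h := dodecForm_line (a := Polynomial.C imUnit) (z := Polynomial.C sixthRoot)
    (by rw [← map_pow, imUnit_sq, map_neg, map_one])
    (by rw [← map_pow, sixthRoot_sq, map_sub, map_one]) Polynomial.X
  rw [hpoly₃, map_dodecForm]
  simp only [map_mul, map_sub, map_one, map_ofNat]
  simpa [lineHom] using h

theorem exists_inv_lineHom_hpoly₃ :
    ∃ c', (135 - 78 * imUnit * (2 * sixthRoot - 1)) * c' = 1 := by
  have ha := imUnit_sq
  have hz := sixthRoot_sq
  obtain ⟨r, hr⟩ : ∃ r : Rring3, 3 * r = 1 :=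
    ⟨⟨3⁻¹, inv_three_mem⟩, Subtype.ext (mul_inv_cancel₀ (by norm_num : (3 : ℂ) ≠ 0))⟩
  have hr3 : 27 * r ^ 3 = 1 := by linear_combination (9 * r ^ 2 + 3 * r + 1) * hr
  refine ⟨-(135 + 78 * imUnit * (2 * sixthRoot - 1)) * r ^ 3, ?_⟩
  linear_combination hr3 + 6084 * r ^ 3 * (2 * sixthRoot - 1) ^ 2 * ha
    - 6084 * 4 * r ^ 3 * hz

theorem eval_gpoly₃ : eval ![1, 0] gpoly₃ = 1 := by
  rw [gpoly₃, map_octForm]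
  simp [octForm]

theorem gpoly₃_ne_zero : gpoly₃ ≠ 0 := by
  intro h
  have := eval_gpoly₃
  simp [h] at this

theorem invariants₃_eq_adjoin : invariants₃ = Algebra.adjoin Rring3 {gpoly₃, hpoly₃} := by
  obtain ⟨c', hc⟩ := exists_inv_lineHom_hpoly₃
  refine eq_adjoin_pair_of_lineHom octSlope_injective 0 invariants₃ gpoly₃_mem hpoly₃_mem
    (isHomogeneous_octForm imUnit).totalDegree_le eval_gpoly₃ lineHom_gpoly₃
    (by norm_num : 12 ≠ 0) hc (isHomogeneous_dodecForm imUnit).totalDegree_le lineHom_hpoly₃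
    (fun P hP => lineHom_octSlope_eq_zero hP)
    (fun P hP n hn => coeff_lineHom_sixthRoot hP hn) fun Q hQ => ?_
  have hg := mem_invariants₃.1 gpoly₃_mem
  rw [mem_invariants₃, map_mul, map_mul, hg.1, hg.2] at hQ
  exact mem_invariants₃.2 ⟨mul_left_cancel₀ gpoly₃_ne_zero hQ.1,
    mul_left_cancel₀ gpoly₃_ne_zero hQ.2⟩

theorem invariantRingC_eq_adjoin :
    invariantRingC Rring3 G8 = Algebra.adjoin ↥Rring3 {gpoly, hpoly} := by
  have h : invariantRingC Rring3 G8 = invariants₃.map toComplex := by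
    rw [invariants₃, Subalgebra.map_comap_eq_self]
    exact inf_le_left
  rw [h, invariants₃_eq_adjoin, AlgHom.map_adjoin, Set.image_pair, toComplex_gpoly₃,
    toComplex_hpoly₃]

theorem algebraicIndependent_gpoly_hpoly : AlgebraicIndependent Rring3 ![gpoly, hpoly] := by
  obtain ⟨c', hc⟩ := exists_inv_lineHom_hpoly₃
  have h := (algebraicIndependent_pair_of_lineHom gpoly₃_ne_zero lineHom_gpoly₃
    (by norm_num : 12 ≠ 0) (left_ne_zero_of_mul (hc ▸ one_ne_zero)) lineHom_hpoly₃).map'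
    toComplex_injective
  convert h using 1
  ext1 i
  fin_cases i
  · exact toComplex_gpoly₃.symm
  · exact toComplex_hpoly₃.symm

end Descent

/-- the ring of invariants `R[1/3][x, y]^{G₈}` is a polynomial ring over
`R[1/3]`; more precisely it equals `R[1/3][g, h]`. -/
theorem G8_invariants_over_one_third :
    invariantRingC Rring3 G8 = Algebra.adjoin ↥Rring3 {gpoly, hpoly} ∧
    ∃ k : ℕ, Nonempty (↥(invariantRingC Rring3 G8) ≃ₐ[↥Rring3] MvPolynomial (Fin k) ↥Rring3) := by
  refine ⟨invariantRingC_eq_adjoin, 2, ⟨?_⟩⟩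
  have hrange : Set.range ![gpoly, hpoly] = {gpoly, hpoly} := by
    simp [Set.pair_comm]
  have e := algebraicIndependent_gpoly_hpoly.aevalEquiv
  rw [hrange] at e
  rw [invariantRingC_eq_adjoin]
  exact e.symm
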